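/- arXiv:1611.01251 — 3 statements merged into one kernel-verified Lean document; each statement's English description precedes it below -/
import Mathlib

section
/- Let F be a field with at least n+k−1 elements, where k ≤ n are positive integers, and fix pairwise distinct α_1,…,α_{n+k−1} ∈ F. Let Z_{n,k} ⊆ F^n be the set of points (z_1,…,z_n) such that z_i ∈ {α_1,…,α_{k+i−1}} for each 1 ≤ i ≤ n, the coordinates z_1,…,z_n are pairwise distinct, and {α_1,…,α_k} ⊆ {z_1,…,z_n}. Then J_{n,k} ⊆ T(Z_{n,k}), where T(Z_{n,k}) is the ideal of F[x_1,…,x_n] generated by the top-degree homogeneous components τ(f) of all nonzero polynomials f vanishing identically on Z_{n,k}. -/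
open scoped Classical
open MvPolynomial

noncomputable section

namespace OSPHecke

/-- Stirling numbers of the second kind. -/
def stirling : ℕ → ℕ → ℕ
  | 0, 0 => 1
  | 0, _ + 1 => 0
  | _ + 1, 0 => 0
  | n + 1, k + 1 => stirling n k + (k + 1) * stirling n (k + 1)

/-- The `q`-analogue `[k]_q = 1 + q + ⋯ + q^{k-1}` as a polynomial in `q` over `ℕ`. -/
def qnat (k : ℕ) : Polynomial ℕ := ∑ t ∈ Finset.range k, Polynomial.X ^ t

/-- The `q`-factorial `[k]!_q`. -/
def qfact : ℕ → Polynomial ℕ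
  | 0 => 1
  | k + 1 => qnat (k + 1) * qfact k

/-- The `q`-Stirling numbers `Stir_q(n,k)`, defined by
`Stir_q(n,k) = Stir_q(n-1,k-1) + [k]_q · Stir_q(n-1,k)` and `Stir_q(0,k) = δ_{0,k}`. -/
def qstirling : ℕ → ℕ → Polynomial ℕ
  | 0, 0 => 1
  | 0, _ + 1 => 0
  | _ + 1, 0 => 0
  | n + 1, k + 1 => qstirling n k + qnat (k + 1) * qstirling n (k + 1)

variable (F : Type*) [Field F]

/-- The complete homogeneous symmetric polynomial of degree `d` in the first `m`
variables `x_1, …, x_m` of `F[x_1, …, x_n]` (variables are 0-indexed). -/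
def hpoly (n d m : ℕ) : MvPolynomial (Fin n) F :=
  ∑ s ∈ Finset.univ.filter (fun s : Sym (Fin n) d => ∀ j ∈ s.1, (j : ℕ) < m),
    (s.1.map MvPolynomial.X).prod

/-- The ideal `J_{n,k}` generated by `h_k(x_1), h_k(x_1,x_2), …, h_k(x_1,…,x_n)` and
`e_n(x_n), e_{n-1}(x_n), …, e_{n-k+1}(x_n)`. -/
def Jideal (n k : ℕ) : Ideal (MvPolynomial (Fin n) F) :=
  Ideal.span ({f | ∃ m, 1 ≤ m ∧ m ≤ n ∧ f = hpoly F n k m} ∪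
    {f | ∃ d, n - k < d ∧ d ≤ n ∧ f = MvPolynomial.esymm (Fin n) F d})

/-- The neglex order on exponent vectors: `a < b` iff there is a position `j` with
`a j < b j` and `a l = b l` for all `l > j`. -/
def NeglexLt {n : ℕ} (a b : Fin n → ℕ) : Prop :=
  ∃ j : Fin n, a j < b j ∧ ∀ l, j < l → a l = b l

/-- The value `w(t+1)` of a permutation at the 1-based position `t+1`
(0-based position `t`); extended by `0` outside the range. -/
def permVal {n : ℕ} (w : Equiv.Perm (Fin n)) (t : ℕ) : ℕ :=
  if h : t < n then (w ⟨t, h⟩ : ℕ) else 0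

/-- The descent set of a permutation, recorded 1-based:
`Des(w) = {j ∈ [n-1] : w(j) > w(j+1)}`. -/
def permDes {n : ℕ} (w : Equiv.Perm (Fin n)) : Finset ℕ :=
  (Finset.Ico 1 n).filter fun j => permVal w j < permVal w (j - 1)

/-- The inversion number (= Coxeter length) of a permutation. -/
def invCount {n : ℕ} (w : Equiv.Perm (Fin n)) : ℕ :=
  ((Finset.univ : Finset (Fin n × Fin n)).filter fun p => p.1 < p.2 ∧ w p.2 < w p.1).card

/-- The descent set (1-based) of a sequence `i = (i_1, i_2, …)`, given 0-based as
`i : ℕ → ℕ`: `Des(i) = {j ∈ [n-1] : i_j > i_{j+1}}`. -/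
def seqDes (n : ℕ) (i : ℕ → ℕ) : Finset ℕ :=
  (Finset.Ico 1 n).filter fun j => i j < i (j - 1)

/-- `α` is a composition of `n`. -/
def IsComposition (n : ℕ) (α : List ℕ) : Prop := α.sum = n ∧ ∀ a ∈ α, 0 < a

/-- The descent set of a composition: the partial sums `α_1, α_1+α_2, …`
excluding the total sum. -/
def desComp (α : List ℕ) : Finset ℕ :=
  ((Finset.range α.length).filter fun t => 0 < t).image fun t => (α.take t).sum

/-- The variable `x_{t+1}` (0-based index `t`), extended by `0` out of range. -/
def Xv (n : ℕ) (t : ℕ) : MvPolynomial (Fin n) F :=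
  if h : t < n then MvPolynomial.X ⟨t, h⟩ else 0

/-- The adjacent transposition exchanging the 0-based indices `t` and `t+1`. -/
def adjSwap (n t : ℕ) : Equiv.Perm (Fin n) :=
  if h : t + 1 < n then Equiv.swap ⟨t, Nat.lt_of_succ_lt h⟩ ⟨t + 1, h⟩ else 1

/-- `PibarRel F n t f g` says that `g = π̄_t(f)`, where (0-based indices `t`, `t+1`)
`π̄_t(f) = (x_{t+1}·(f - s_t(f)))/(x_t - x_{t+1}) = π_t(f) - f`; since `F[x]` is an
integral domain such a `g` is unique when it exists (and it always exists). -/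
def PibarRel (n t : ℕ) (f g : MvPolynomial (Fin n) F) : Prop :=
  (Xv F n t - Xv F n (t + 1)) * g =
    Xv F n (t + 1) * (f - MvPolynomial.rename (⇑(adjSwap n t)) f)

/-- The permutation associated to a word of (0-based) adjacent transposition indices. -/
def wordPerm (n : ℕ) (L : List ℕ) : Equiv.Perm (Fin n) := (L.map (adjSwap n)).prod

/-- `L` is a reduced word for `w`. -/
def IsReducedWord (n : ℕ) (L : List ℕ) (w : Equiv.Perm (Fin n)) : Prop :=
  (∀ t ∈ L, t + 1 < n) ∧ wordPerm n L = w ∧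
    ∀ L' : List ℕ, (∀ t ∈ L', t + 1 < n) → wordPerm n L' = w → L.length ≤ L'.length

/-- `g` is a chain of successive applications of the operators `π̄` along the word `L`,
applied right-to-left (so `g (t+1) = π̄_{L.reverse[t]} (g t)`). -/
def PibarChain (n : ℕ) (L : List ℕ) (g : ℕ → MvPolynomial (Fin n) F) : Prop :=
  ∀ t, t < L.length → PibarRel F n (L.reverse.getD t 0) (g t) (g (t + 1))

/-- `p = π̄_w(f)`, computed along some reduced word for `w`. -/
def IsPibarApplied (n : ℕ) (w : Equiv.Perm (Fin n)) (f p : MvPolynomial (Fin n) F) : Prop :=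
  ∃ (L : List ℕ) (g : ℕ → MvPolynomial (Fin n) F),
    IsReducedWord n L w ∧ g 0 = f ∧ PibarChain F n L g ∧ g L.length = p

/-- The monomial `x_{α,i} = (∏_{j ∈ Des(α)} x_1⋯x_j) · x_1^{i_1}⋯x_n^{i_n}`. -/
def xAI (n : ℕ) (α : List ℕ) (i : ℕ → ℕ) : MvPolynomial (Fin n) F :=
  (∏ j ∈ desComp α, ∏ t ∈ Finset.range j, Xv F n t) *
    ∏ t ∈ Finset.range n, Xv F n t ^ i t

/-- The defining conditions for the index set `A_{n,k}`: `α` is a composition of `n`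
with `α_1 > n-k`, and `k - ℓ(α) ≥ i_1 ≥ ⋯ ≥ i_{n-k} ≥ 0 = i_{n-k+1} = ⋯ = i_n`
(the sequence `i` is 0-indexed: `i t` is the paper's `i_{t+1}`). -/
def Acond (n k : ℕ) (α : List ℕ) (i : ℕ → ℕ) : Prop :=
  IsComposition n α ∧ n - k < α.headI ∧ i 0 + α.length ≤ k ∧
    (∀ a b, a ≤ b → b < n - k → i b ≤ i a) ∧ ∀ t, n - k ≤ t → i t = 0

/-- The exponent vector of the generalized Garsia–Stanton monomial `gs_{w,i}`:
the variable `x_{w(t)}` has exponent `#{d ∈ Des(w) : d ≥ t} + i_t` (1-based `t`). -/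
def gsExp {n : ℕ} (w : Equiv.Perm (Fin n)) (i : ℕ → ℕ) : Fin n → ℕ := fun m =>
  ((permDes w).filter fun r => (w.symm m : ℕ) + 1 ≤ r).card + i (w.symm m : ℕ)

/-- The generalized Garsia–Stanton monomial `gs_{w,i}`. -/
def gsMono (n : ℕ) (w : Equiv.Perm (Fin n)) (i : ℕ → ℕ) : MvPolynomial (Fin n) F :=
  ∏ m : Fin n, MvPolynomial.X m ^ gsExp w i m

/-- The condition `k - des(w) > i_1 ≥ ⋯ ≥ i_{n-k} ≥ 0 = i_{n-k+1} = ⋯ = i_n` defining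
membership of `gs_{w,i}` in `GS_{n,k}`. -/
def GScond (n k : ℕ) (w : Equiv.Perm (Fin n)) (i : ℕ → ℕ) : Prop :=
  i 0 + (permDes w).card < k ∧ (∀ a b, a ≤ b → b < n - k → i b ≤ i a) ∧
    ∀ t, n - k ≤ t → i t = 0

/-- An ordered set partition of `[n]` with `k` blocks: a `k`-tuple of nonempty,
pairwise disjoint subsets of `Fin n` covering `Fin n`. -/
def OSP (n k : ℕ) : Type :=
  {B : Fin k → Finset (Fin n) // (∀ j, (B j).Nonempty) ∧
    (∀ j l, j ≠ l → ∀ x, x ∈ B j → x ∉ B l) ∧ ∀ x, ∃ j, x ∈ B j}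

/-- Relabelling the letters of an ordered set partition by a permutation. -/
def ospMap {n k : ℕ} (e : Equiv.Perm (Fin n)) (σ : OSP n k) : OSP n k :=
  ⟨fun j => (σ.1 j).image e, by
    obtain ⟨h1, h2, h3⟩ := σ.2
    refine ⟨fun j => (h1 j).image e, fun j l hjl x hx hx' => ?_, fun x => ?_⟩
    · rcases Finset.mem_image.1 hx with ⟨y, hy, hey⟩
      rcases Finset.mem_image.1 hx' with ⟨y', hy', hey'⟩
      have : y = y' := e.injective (hey.trans hey'.symm)
      exact h2 j l hjl y hy (this ▸ hy')
    · rcases h3 (e.symm x) with ⟨j, hj⟩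
      exact ⟨j, Finset.mem_image.2 ⟨e.symm x, hj, e.apply_symm_apply x⟩⟩⟩

/-- `b` lies in a block strictly to the left of the block of `a`. -/
def leftOf {n k : ℕ} (σ : OSP n k) (a b : Fin n) : Prop :=
  ∃ p q : Fin k, p < q ∧ b ∈ σ.1 p ∧ a ∈ σ.1 q

/-- `a` and `b` lie in the same block. -/
def sameBlock {n k : ℕ} (σ : OSP n k) (a b : Fin n) : Prop :=
  ∃ p : Fin k, a ∈ σ.1 p ∧ b ∈ σ.1 p

/-- The value of the 0-Hecke generator `π` (for the pair of letters `a = i`,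
`b = i+1`) on a basis element of `F[OP_{n,k}]`. -/
def heckeImg {n k : ℕ} (a b : Fin n) (σ : OSP n k) : OSP n k →₀ F :=
  if leftOf σ a b then 0
  else if sameBlock σ a b then Finsupp.single σ 1
  else Finsupp.single σ 1 + Finsupp.single (ospMap (Equiv.swap a b) σ) 1

/-- The 0-Hecke operator `π` on `F[OP_{n,k}]` for the pair of letters `a = i`, `b = i+1`. -/
def heckeOp {n k : ℕ} (a b : Fin n) (f : OSP n k →₀ F) : OSP n k →₀ F :=
  f.sum fun σ c => c • heckeImg F a b σ

/-- The value of the 0-Hecke generator `π̄ = π - 1` on a basis element of `F[OP_{n,k}]`. -/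
def pibarImg {n k : ℕ} (a b : Fin n) (σ : OSP n k) : OSP n k →₀ F :=
  if leftOf σ a b then -Finsupp.single σ 1
  else if sameBlock σ a b then 0
  else Finsupp.single (ospMap (Equiv.swap a b) σ) 1

/-- The 0-Hecke operator `π̄ = π - 1` on `F[OP_{n,k}]`. -/
def pibarOp {n k : ℕ} (a b : Fin n) (f : OSP n k →₀ F) : OSP n k →₀ F :=
  f.sum fun σ c => c • pibarImg F a b σ

/-- `IsShuffle l₁ l₂ l` : `l` is an interleaving of `l₁` and `l₂` preserving the
relative order of the entries of each. -/
inductive IsShuffle : List ℕ → List ℕ → List ℕ → Prop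
  | nil : IsShuffle [] [] []
  | left {a l₁ l₂ l} : IsShuffle l₁ l₂ l → IsShuffle (a :: l₁) l₂ (a :: l)
  | right {a l₁ l₂ l} : IsShuffle l₁ l₂ l → IsShuffle l₁ (a :: l₂) (a :: l)

/-- An `(n,k)`-staircase: a shuffle of `(k-1, k-2, …, 1, 0)` with `n-k` copies of `k-1`. -/
def IsStaircase (n k : ℕ) (s : Fin n → ℕ) : Prop :=
  ∃ L : List ℕ, IsShuffle ((List.range k).reverse) (List.replicate (n - k) (k - 1)) L ∧
    ∀ j : Fin n, s j = L.getD (j : ℕ) 0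

/-- `B` is an ordered set partition of `[n]` (`n = α.sum`) of shape `α`. -/
def IsOSPShape (α : List ℕ) (B : Fin α.length → Finset (Fin α.sum)) : Prop :=
  (∀ j, (B j).card = α.get j) ∧
    (∀ j l, j ≠ l → ∀ x, x ∈ B j → x ∉ B l) ∧ ∀ x, ∃ j, x ∈ B j

/-- The ordered set partition `({1,…,α_1} | {α_1+1,…,α_1+α_2} | ⋯)` of shape `α`,
as a tuple of blocks. -/
def sigma0 (α : List ℕ) : Fin α.length → Finset (Fin α.sum) := fun j =>
  Finset.univ.filter fun x =>
    (α.take (j : ℕ)).sum ≤ (x : ℕ) ∧ (x : ℕ) < (α.take ((j : ℕ) + 1)).sum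

section Shape

variable {n ℓ : ℕ}

/-- `b` lies in a block strictly to the left of the block of `a` (tuples of blocks). -/
def blkLeft (B : Fin ℓ → Finset (Fin n)) (a b : Fin n) : Prop :=
  ∃ p q : Fin ℓ, p < q ∧ b ∈ B p ∧ a ∈ B q

/-- `a` and `b` lie in the same block (tuples of blocks). -/
def blkSame (B : Fin ℓ → Finset (Fin n)) (a b : Fin n) : Prop :=
  ∃ p : Fin ℓ, a ∈ B p ∧ b ∈ B p

/-- The value of the 0-Hecke generator `π` (for letters `a = i`, `b = i+1`) on a basis
element of the free module on tuples of blocks. -/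
def shapeImg (a b : Fin n) (B : Fin ℓ → Finset (Fin n)) :
    (Fin ℓ → Finset (Fin n)) →₀ F :=
  if blkLeft B a b then 0
  else if blkSame B a b then Finsupp.single B 1
  else Finsupp.single B 1 + Finsupp.single (fun j => (B j).image (Equiv.swap a b)) 1

/-- The 0-Hecke operator `π` on the free module on tuples of blocks. -/
def shapeOp (a b : Fin n) (f : (Fin ℓ → Finset (Fin n)) →₀ F) :
    (Fin ℓ → Finset (Fin n)) →₀ F :=
  f.sum fun B c => c • shapeImg F a b B

end Shape

/-- A `k`-tuple of blocks is an ordered set partition of `[n]` with `k` blocks. -/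
def IsOSPFun {n k : ℕ} (B : Fin k → Finset (Fin n)) : Prop :=
  (∀ j, (B j).Nonempty) ∧ (∀ j l, j ≠ l → ∀ x, x ∈ B j → x ∉ B l) ∧ ∀ x, ∃ j, x ∈ B j

/-- The `t`-th block (0-based) of a tuple of blocks, extended by `∅` out of range. -/
def blockExt {n k : ℕ} (B : Fin k → Finset (Fin n)) (t : ℕ) : Finset (Fin n) :=
  if h : t < k then B ⟨t, h⟩ else ∅

/-- The word (values in `{1, …, n}`) obtained by listing the elements of each block in
increasing order, reading the blocks from left to right. -/
def ospWord {n k : ℕ} (B : Fin k → Finset (Fin n)) : List ℕ :=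
  (List.finRange k).flatMap fun j => ((B j).sort (· ≤ ·)).map fun x => (x : ℕ) + 1

/-- The major index of a word: the sum of the (1-based) positions `j` with
`L_j > L_{j+1}`. -/
def wordMaj (L : List ℕ) : ℕ :=
  ∑ j ∈ Finset.range (L.length - 1), if L.getD (j + 1) 0 < L.getD j 0 then j + 1 else 0

/-- The major index of an ordered set partition `σ = (B_1 | ⋯ | B_k)`:
`maj(σ) = maj(w) + ∑_{i : max(B_i) < min(B_{i+1})} (α_1 + ⋯ + α_i - i)`. -/
def ospMaj {n k : ℕ} (B : Fin k → Finset (Fin n)) : ℕ :=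
  wordMaj (ospWord B) +
    ∑ t ∈ Finset.range (k - 1),
      if ∀ a ∈ blockExt B t, ∀ b ∈ blockExt B (t + 1), a < b then
        (∑ j ∈ Finset.range (t + 1), (blockExt B j).card) - (t + 1)
      else 0

/-- The complete homogeneous symmetric function of degree `d` evaluated at field
elements `v_1, …, v_n`. -/
def hval {n : ℕ} (v : Fin n → F) (d : ℕ) : F :=
  ∑ s ∈ (Finset.univ : Finset (Sym (Fin n) d)), (s.1.map v).prod

/-- The elementary symmetric function of degree `d` evaluated at field elements
`v_1, …, v_n` (it vanishes for `d > n`). -/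
def esymval {n : ℕ} (v : Fin n → F) (d : ℕ) : F :=
  ∑ t ∈ Finset.powersetCard d Finset.univ, ∏ j ∈ t, v j

end OSPHecke

namespace OSPHecke

/-- The point set `Z_{n,k} ⊆ F^n` attached to the distinct field elements
`α_1, …, α_{n+k-1}`: points with distinct coordinates, `z_i ∈ {α_1, …, α_{k+i-1}}`, and
`{α_1, …, α_k} ⊆ {z_1, …, z_n}`. (0-based: `a m` is `α_{m+1}` and `z i` is `z_{i+1}`.) -/
def Zset (F : Type*) [Field F] (n k : ℕ) (a : Fin (n + k - 1) → F) :
    Set (Fin n → F) :=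
  {z | (∀ i : Fin n, ∃ m : Fin (n + k - 1), (m : ℕ) < k + (i : ℕ) ∧ z i = a m) ∧
    Function.Injective z ∧
    ∀ m : Fin (n + k - 1), (m : ℕ) < k → ∃ i : Fin n, z i = a m}

/-- Adding lower-order corrections `c` to a homogeneous polynomial `g d` so that the result
vanishes on `Z` exhibits `g d` as a top-degree component. -/
theorem mem_span_topComponent_of_coeff_mul_eq_zero {σ F : Type*} [Field F] (Z : Set (σ → F))
    (g : ℕ → MvPolynomial σ F) (hg : ∀ i, (g i).IsHomogeneous i) (c : PowerSeries F)
    (hc : PowerSeries.coeff 0 c = 1) (d : ℕ)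
    (h : ∀ z ∈ Z, PowerSeries.coeff d (c * PowerSeries.mk fun i => eval z (g i)) = 0) :
    g d ∈ Ideal.span {p : MvPolynomial σ F | ∃ f : MvPolynomial σ F, f ≠ 0 ∧
      (∀ z ∈ Z, eval z f = 0) ∧ p = homogeneousComponent f.totalDegree f} := by
  by_cases h0 : g d = 0
  · rw [h0]
    exact zero_mem _
  set f : MvPolynomial σ F :=
    ∑ p ∈ Finset.HasAntidiagonal.antidiagonal d, C (PowerSeries.coeff p.1 c) * g p.2 with hf
  have htop : homogeneousComponent d f = g d := by
    rw [hf, map_sum, Finset.sum_eq_single (0, d)]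
    · rw [homogeneousComponent_C_mul, homogeneousComponent_of_mem (hg d), if_pos rfl, hc, C_1,
        one_mul]
    · rintro ⟨i, j⟩ hij hne
      rw [Finset.HasAntidiagonal.mem_antidiagonal] at hij
      have hj : j ≠ d := by
        rintro rfl
        exact hne (by simp_all)
      rw [homogeneousComponent_C_mul, homogeneousComponent_of_mem (hg j), if_neg hj.symm, mul_zero]
    · simp
  have hle : f.totalDegree ≤ d := by
    refine totalDegree_finsetSum_le fun p hp => ?_
    rw [Finset.HasAntidiagonal.mem_antidiagonal] at hp
    exact ((hg p.2).C_mul _).totalDegree_le.trans (by omega)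
  have hdeg : f.totalDegree = d := by
    refine hle.antisymm (not_lt.1 fun hlt => h0 ?_)
    rw [← htop, homogeneousComponent_eq_zero _ _ hlt]
  refine Ideal.subset_span ⟨f, ?_, fun z hz => ?_, ?_⟩
  · intro hf0
    exact h0 (by rw [← htop, hf0, map_zero])
  · have := h z hz
    rw [PowerSeries.coeff_mul] at this
    simpa [hf] using this
  · rw [hdeg, htop]

theorem coeff_prod_one_add_C_mul_X {ι R : Type*} [CommSemiring R] (s : Finset ι) (b : ι → R)
    (d : ℕ) :
    PowerSeries.coeff d (∏ i ∈ s, (1 + PowerSeries.C (b i) * PowerSeries.X)) =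
      ∑ t ∈ s.powersetCard d, ∏ i ∈ t, b i := by
  rw [Finset.prod_one_add, map_sum, Finset.powersetCard_eq_filter, Finset.sum_filter]
  refine Finset.sum_congr rfl fun t _ => ?_
  rw [Finset.prod_mul_distrib, Finset.prod_const, ← map_prod, PowerSeries.coeff_C_mul,
    PowerSeries.coeff_X_pow]
  simp [eq_comm]

theorem coeff_prod_one_add_C_mul_X_eq_zero {ι R : Type*} [CommSemiring R] (s : Finset ι)
    (b : ι → R) {d : ℕ} (hd : s.card < d) :
    PowerSeries.coeff d (∏ i ∈ s, (1 + PowerSeries.C (b i) * PowerSeries.X)) = 0 := by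
  rw [coeff_prod_one_add_C_mul_X, Finset.powersetCard_eq_empty.2 hd, Finset.sum_empty]

theorem sum_sym_map_prod_eq_coeff_prod {ι R : Type*} [Fintype ι] [DecidableEq ι] [CommSemiring R]
    (s : Finset ι) (v : ι → R) (d : ℕ) :
    ∑ m ∈ Finset.univ.filter (fun m : Sym ι d => ∀ j ∈ m.1, j ∈ s), (m.1.map v).prod =
      PowerSeries.coeff d (∏ i ∈ s, PowerSeries.mk fun e => v i ^ e) := by
  rw [PowerSeries.coeff_prod]
  simp only [PowerSeries.coeff_mk]
  refine Finset.sum_bij' (fun m _ => Multiset.toFinsupp m.1)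
    (fun l hl => ⟨Finsupp.toMultiset l, ?_⟩) ?_ ?_ ?_ ?_ ?_
  · rw [Finset.mem_finsuppAntidiag'] at hl
    rw [Finsupp.card_toMultiset, ← hl.1]
    rfl
  · rintro ⟨m, rfl⟩ hm
    have hm := Finset.mem_filter.1 hm
    rw [Finset.mem_finsuppAntidiag']
    refine ⟨?_, fun j hj => hm.2 j ?_⟩
    · change Finsupp.sum _ (fun _ => id) = _
      rw [← Finsupp.card_toMultiset, Multiset.toFinsupp_toMultiset]
    · simpa using hj
  · intro l hl
    rw [Finset.mem_finsuppAntidiag'] at hl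
    refine Finset.mem_filter.2 ⟨Finset.mem_univ _, fun j hj => hl.2 ?_⟩
    simpa using hj
  · intro m _
    exact Subtype.ext (Multiset.toFinsupp_toMultiset _)
  · intro l _
    exact Finsupp.toMultiset_toFinsupp _
  · intro m hm
    have hm := Finset.mem_filter.1 hm
    rw [Finset.prod_multiset_map_count]
    refine Finset.prod_subset (fun j hj => hm.2 j (Multiset.mem_toFinset.1 hj)) fun j _ hj => ?_
    rw [Multiset.count_eq_zero_of_notMem (mt Multiset.mem_toFinset.2 hj), pow_zero]

theorem mk_pow_mul_one_sub_C_mul_X {R : Type*} [CommRing R] (x : R) :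
    (PowerSeries.mk fun e => x ^ e) * (1 + PowerSeries.C (-x) * PowerSeries.X) = 1 := by
  ext d
  cases d with
  | zero => simp [mul_add]
  | succ d =>
    rw [mul_add, mul_one, ← mul_assoc, map_add, PowerSeries.coeff_succ_mul_X,
      PowerSeries.coeff_mul_C]
    simp [PowerSeries.coeff_one, pow_succ]

theorem hpoly_isHomogeneous (F : Type*) [Field F] (n d m : ℕ) :
    (hpoly F n d m).IsHomogeneous d := by
  refine IsHomogeneous.sum _ _ _ fun s _ => ?_
  rw [Finset.prod_multiset_map_count]
  convert IsHomogeneous.prod s.1.toFinset (fun i => (X i : MvPolynomial (Fin n) F) ^ s.1.count i)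
    (fun i => s.1.count i) fun i _ => isHomogeneous_X_pow i _
  rw [Multiset.toFinset_sum_count_eq]
  exact s.2.symm

theorem eval_hpoly (F : Type*) [Field F] (n d m : ℕ) (z : Fin n → F) :
    eval z (hpoly F n d m) = PowerSeries.coeff d
      (∏ i ∈ Finset.univ.filter (fun i : Fin n => (i : ℕ) < m),
        PowerSeries.mk fun e => z i ^ e) := by
  rw [← sum_sym_map_prod_eq_coeff_prod, hpoly, map_sum]
  refine Finset.sum_congr (by ext; simp) fun s _ => ?_
  rw [map_multiset_prod, Multiset.map_map]
  simp

theorem esymm_isHomogeneous (σ R : Type*) [Fintype σ] [CommSemiring R] (d : ℕ) :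
    (esymm σ R d).IsHomogeneous d := by
  refine IsHomogeneous.sum _ _ _ fun t ht => ?_
  rw [Finset.mem_powersetCard] at ht
  convert IsHomogeneous.prod t (fun i => (X i : MvPolynomial σ R)) (fun _ => 1)
    fun i _ => isHomogeneous_X R i
  simp [ht.2]

theorem eval_esymm {σ R : Type*} [Fintype σ] [CommSemiring R] (d : ℕ) (z : σ → R) :
    eval z (esymm σ R d) =
      PowerSeries.coeff d (∏ i, (1 + PowerSeries.C (z i) * PowerSeries.X)) := by
  rw [coeff_prod_one_add_C_mul_X]
  simp [esymm]

theorem card_filter_fin_lt {N r : ℕ} (h : r ≤ N) :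
    (Finset.univ.filter fun i : Fin N => (i : ℕ) < r).card = r := by
  rw [Fin.card_filter_val_lt, min_eq_right h]

theorem hpoly_mem_span_topComponent (F : Type*) [Field F] (n k : ℕ) (hk : 1 ≤ k)
    (a : Fin (n + k - 1) → F) (m : ℕ) (hmn : m ≤ n) :
    hpoly F n k m ∈ Ideal.span {p : MvPolynomial (Fin n) F | ∃ f : MvPolynomial (Fin n) F,
      f ≠ 0 ∧ (∀ z ∈ Zset F n k a, eval z f = 0) ∧
        p = homogeneousComponent f.totalDegree f} := by
  set A := Finset.univ.filter fun j : Fin (n + k - 1) => (j : ℕ) < k + m - 1 with hA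
  refine mem_span_topComponent_of_coeff_mul_eq_zero _ (fun d => hpoly F n d m)
    (fun d => hpoly_isHomogeneous F n d m)
    (∏ j ∈ A, (1 + PowerSeries.C (-a j) * PowerSeries.X)) (by simp [map_prod]) k ?_
  rintro z ⟨hz, hinj, -⟩
  choose q hq hzq using hz
  have hqi : Function.Injective q := fun i j hij => hinj (by rw [hzq, hzq, hij])
  set S := Finset.univ.filter fun i : Fin n => (i : ℕ) < m with hS
  have hsub : S.image q ⊆ A := by
    intro j hj
    obtain ⟨i, hi, rfl⟩ := Finset.mem_image.1 hj
    have hi' := (Finset.mem_filter.1 hi).2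
    have := hq i
    exact Finset.mem_filter.2 ⟨Finset.mem_univ _, by omega⟩
  have hcard : (A \ S.image q).card < k := by
    rw [Finset.card_sdiff_of_subset hsub, Finset.card_image_of_injective _ hqi, hA, hS,
      card_filter_fin_lt (by omega), card_filter_fin_lt hmn]
    omega
  have hgen : (PowerSeries.mk fun d => eval z (hpoly F n d m)) =
      ∏ i ∈ S, PowerSeries.mk fun e => z i ^ e := by
    ext d
    rw [PowerSeries.coeff_mk, eval_hpoly]
  have hprod : ∏ j ∈ S.image q, (1 + PowerSeries.C (-a j) * PowerSeries.X) =
      ∏ i ∈ S, (1 + PowerSeries.C (-z i) * PowerSeries.X) := by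
    rw [Finset.prod_image hqi.injOn]
    simp only [hzq]
  rw [hgen, ← Finset.prod_sdiff hsub, hprod, mul_assoc, ← Finset.prod_mul_distrib,
    Finset.prod_congr rfl fun i _ => (mul_comm _ _).trans (mk_pow_mul_one_sub_C_mul_X (z i)),
    Finset.prod_const_one, mul_one]
  exact coeff_prod_one_add_C_mul_X_eq_zero _ _ hcard

theorem esymm_mem_span_topComponent (F : Type*) [Field F] (n k : ℕ) (hkn : k ≤ n)
    (a : Fin (n + k - 1) → F) (ha : Function.Injective a) (d : ℕ) (hd : n - k < d) :
    esymm (Fin n) F d ∈ Ideal.span {p : MvPolynomial (Fin n) F | ∃ f : MvPolynomial (Fin n) F,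
      f ≠ 0 ∧ (∀ z ∈ Zset F n k a, eval z f = 0) ∧
        p = homogeneousComponent f.totalDegree f} := by
  set A := Finset.univ.filter fun j : Fin (n + k - 1) => (j : ℕ) < k with hA
  refine mem_span_topComponent_of_coeff_mul_eq_zero _ (fun d => esymm (Fin n) F d)
    (fun d => esymm_isHomogeneous (Fin n) F d)
    (∏ j ∈ A, PowerSeries.mk fun e => (-a j) ^ e) (by simp [map_prod]) d ?_
  rintro z ⟨hz, hinj, hmem⟩
  choose q hq hzq using hz
  have hqi : Function.Injective q := fun i j hij => hinj (by rw [hzq, hzq, hij])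
  have hsub : A ⊆ Finset.univ.image q := by
    intro j hj
    obtain ⟨i, hi⟩ := hmem j (Finset.mem_filter.1 hj).2
    exact Finset.mem_image.2 ⟨i, Finset.mem_univ _, ha (by rw [← hzq, hi])⟩
  have hcard : (Finset.univ.image q \ A).card < d := by
    rw [Finset.card_sdiff_of_subset hsub, Finset.card_image_of_injective _ hqi, hA,
      card_filter_fin_lt (by omega), Finset.card_univ, Fintype.card_fin]
    exact hd
  have hgen : (PowerSeries.mk fun d => eval z (esymm (Fin n) F d)) =
      ∏ j ∈ Finset.univ.image q, (1 + PowerSeries.C (a j) * PowerSeries.X) := by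
    ext d
    rw [PowerSeries.coeff_mk, eval_esymm, Finset.prod_image hqi.injOn]
    simp only [hzq]
  have hinv (j) : (PowerSeries.mk fun e => (-a j) ^ e) *
      (1 + PowerSeries.C (a j) * PowerSeries.X) = 1 := by
    simpa using mk_pow_mul_one_sub_C_mul_X (-a j)
  rw [hgen, ← Finset.prod_sdiff hsub, mul_left_comm, ← Finset.prod_mul_distrib,
    Finset.prod_congr rfl fun j _ => hinv j, Finset.prod_const_one, mul_one]
  exact coeff_prod_one_add_C_mul_X_eq_zero _ _ hcard

/-- If `F` has at least `n+k-1` elements (witnessed by the injection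
`a : Fin (n+k-1) → F`), then `J_{n,k} ⊆ T(Z_{n,k})`, where `T(Z_{n,k})` is the ideal
generated by the top-degree homogeneous components of the nonzero polynomials vanishing
on `Z_{n,k}`. -/
theorem Jideal_le_gradedVanishing (F : Type*) [Field F] (n k : ℕ)
    (hk : 1 ≤ k) (hkn : k ≤ n)
    (a : Fin (n + k - 1) → F) (ha : Function.Injective a) :
    Jideal F n k ≤
      Ideal.span {p : MvPolynomial (Fin n) F |
        ∃ f : MvPolynomial (Fin n) F, f ≠ 0 ∧
          (∀ z ∈ Zset F n k a, MvPolynomial.eval z f = 0) ∧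
          p = MvPolynomial.homogeneousComponent f.totalDegree f} := by
  refine Ideal.span_le.2 ?_
  rintro _ (⟨m, -, hmn, rfl⟩ | ⟨d, hd, -, rfl⟩)
  · exact hpoly_mem_span_topComponent F n k hk a m hmn
  · exact esymm_mem_span_topComponent F n k hkn a ha d hd

end OSPHecke
end
end

section
/- Let F be a field and k ≤ n positive integers. Let (α, i) ∈ A_{n,k} and let w ∈ S_n satisfy Des(α) ⊆ Des(w) ⊆ Des(α ∪ i). Then for any reduced word of w, the polynomial π̄_w(x_{α,i}) has neglex-leading term (with coefficient 1) equal to the monomial w(x_{α,i}) obtained by substituting x_{w(j)} for x_j in x_{α,i}; moreover w(x_{α,i}) = gs_{w,i'} where i'_j := i_j − |{r ∈ Des(w) ∩ [n−k] : r ≥ j}| for each j, and gs_{w,i'} belongs to GS_{n,k} (i.e., k − des(w) > i'_1 ≥ ⋯ ≥ i'_{n−k} ≥ 0 = i'_{n−k+1} = ⋯ = i'_n). -/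
open scoped Classical
open MvPolynomial

noncomputable section

namespace OSPHecke

/-- The sum of the entries of `f` at positions `≥ M`. -/
def suffixSum {n : ℕ} (f : Fin n → ℕ) (M : ℕ) : ℕ :=
  ∑ m : Fin n, if M ≤ (m : ℕ) then f m else 0

theorem suffixSum_eq_add {n : ℕ} (f : Fin n → ℕ) (i : Fin n) :
    suffixSum f i = f i + suffixSum f (i + 1) := by
  have h : f i = ∑ m : Fin n, if m = i then f m else 0 := by simp
  unfold suffixSum
  rw [h, ← Finset.sum_add_distrib]
  refine Finset.sum_congr rfl fun m _ => ?_
  rcases lt_trichotomy m i with h | h | h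
  · have h1 : ¬ (i : ℕ) ≤ m := by simpa using h
    have h2 : ¬ (i : ℕ) + 1 ≤ m := by omega
    simp [h1, h2, h.ne]
  · subst h; simp
  · have h1 : (i : ℕ) + 1 ≤ m := h
    have h2 : (i : ℕ) ≤ m := by omega
    simp [h1, h2, h.ne']

theorem suffixSum_comp_swap {n : ℕ} (f : Fin n → ℕ) {i j : Fin n} (hij : (j : ℕ) = i + 1)
    {M : ℕ} (hM : M ≠ j) : suffixSum (f ∘ Equiv.swap i j) M = suffixSum f M := by
  unfold suffixSum
  rw [← Equiv.sum_comp (Equiv.swap i j)]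
  refine Finset.sum_congr rfl fun m _ => ?_
  have : M ≤ (Equiv.swap i j m : ℕ) ↔ M ≤ (m : ℕ) := by
    by_cases h1 : m = i
    · subst h1; rw [Equiv.swap_apply_left]; omega
    · by_cases h2 : m = j
      · subst h2; rw [Equiv.swap_apply_right]; omega
      · rw [Equiv.swap_apply_of_ne_of_ne h1 h2]
  simp only [this, Function.comp, Equiv.swap_apply_self]

theorem suffixSum_swap_at {n : ℕ} (f : Fin n → ℕ) {i j : Fin n} (hij : (j : ℕ) = i + 1) :
    suffixSum (f ∘ Equiv.swap i j) j = f i + suffixSum f (j + 1) := by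
  rw [suffixSum_eq_add, suffixSum_comp_swap f hij (by omega)]
  simp

theorem neglexLt_of_suffixSum_le {n : ℕ} {d f : Fin n → ℕ}
    (h : ∀ M, suffixSum d M ≤ suffixSum f M) (hne : d ≠ f) : NeglexLt d f := by
  obtain ⟨m, hm⟩ := Function.ne_iff.1 hne
  obtain ⟨j, hj, hmax⟩ := (Finset.univ.filter fun m => d m ≠ f m).exists_maximal
    ⟨m, by simpa using hm⟩
  simp only [Finset.mem_filter, Finset.mem_univ, true_and] at hj hmax
  have hgt : ∀ l, j < l → d l = f l := fun l hl => by
    by_contra hne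
    exact absurd (hmax hne hl.le) (not_le.2 hl)
  refine ⟨j, ?_, hgt⟩
  have h1 : suffixSum d (j + 1) = suffixSum f (j + 1) := by
    refine Finset.sum_congr rfl fun l _ => ?_
    split_ifs with hl
    · exact hgt l hl
    · rfl
  have := h j
  rw [suffixSum_eq_add, suffixSum_eq_add] at this
  omega

theorem adjSwap_of_lt {n t : ℕ} (h : t + 1 < n) :
    adjSwap n t = Equiv.swap ⟨t, Nat.lt_of_succ_lt h⟩ ⟨t + 1, h⟩ := dif_pos h

theorem adjSwap_mul_self (n t : ℕ) : adjSwap n t * adjSwap n t = 1 := by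
  unfold adjSwap
  split_ifs <;> simp

theorem wordPerm_cons (n t : ℕ) (L : List ℕ) :
    wordPerm n (t :: L) = adjSwap n t * wordPerm n L := by
  simp [wordPerm]

/-- The exchange property for words in the adjacent transpositions. -/
theorem exists_shorter_word {n : ℕ} {a b : Fin n} (hab : a < b) (L : List ℕ)
    (hL : ∀ t ∈ L, t + 1 < n) (hinv : wordPerm n L b < wordPerm n L a) :
    ∃ L' : List ℕ, (∀ t ∈ L', t + 1 < n) ∧ L'.length + 1 = L.length ∧
      wordPerm n L' = wordPerm n L * Equiv.swap a b := by
  induction L with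
  | nil => exact absurd hinv (by simpa [wordPerm] using hab.le)
  | cons t L ih =>
    have ht : t + 1 < n := hL t (by simp)
    have hL' : ∀ s ∈ L, s + 1 < n := fun s hs => hL s (by simp [hs])
    rw [wordPerm_cons] at hinv
    by_cases hv : wordPerm n L b < wordPerm n L a
    · obtain ⟨L', h1, h2, h3⟩ := ih hL' hv
      refine ⟨t :: L', ?_, by simpa using h2, ?_⟩
      · simpa [ht] using h1
      · rw [wordPerm_cons, wordPerm_cons, h3, mul_assoc]
    · have hne : wordPerm n L a ≠ wordPerm n L b := fun h =>
        hab.ne ((wordPerm n L).injective h)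
      have hlt : wordPerm n L a < wordPerm n L b := lt_of_le_of_ne (not_lt.1 hv) hne
      rw [adjSwap_of_lt ht] at hinv
      have key : wordPerm n L a = ⟨t, Nat.lt_of_succ_lt ht⟩ ∧
          wordPerm n L b = ⟨t + 1, ht⟩ := by
        simp only [Equiv.Perm.mul_apply, Equiv.swap_apply_def] at hinv
        simp only [Fin.ext_iff, Fin.lt_def] at hinv hlt ⊢
        split_ifs at hinv <;> simp_all <;> omega
      refine ⟨L, hL', rfl, ?_⟩
      rw [wordPerm_cons, adjSwap_of_lt ht, ← key.1, ← key.2, mul_assoc,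
        Equiv.mul_swap_eq_swap_mul, ← mul_assoc]
      simp

theorem IsReducedWord.of_cons {n t : ℕ} {L : List ℕ} {w : Equiv.Perm (Fin n)}
    (h : IsReducedWord n (t :: L) w) : IsReducedWord n L (wordPerm n L) := by
  obtain ⟨h1, h2, h3⟩ := h
  refine ⟨fun s hs => h1 s (by simp [hs]), rfl, fun L' hL' hw => ?_⟩
  have := h3 (t :: L') (by simpa [h1 t (by simp)] using hL')
    (by rw [← h2, wordPerm_cons, wordPerm_cons, hw])
  simpa using this

theorem IsReducedWord.symm_lt_symm {n t : ℕ} {L : List ℕ} {w : Equiv.Perm (Fin n)}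
    (h : IsReducedWord n (t :: L) w) (ht : t + 1 < n) :
    (wordPerm n L).symm ⟨t, Nat.lt_of_succ_lt ht⟩ < (wordPerm n L).symm ⟨t + 1, ht⟩ := by
  obtain ⟨h1, h2, h3⟩ := h
  by_contra hlt
  have hne : (wordPerm n L).symm ⟨t + 1, ht⟩ ≠ (wordPerm n L).symm ⟨t, Nat.lt_of_succ_lt ht⟩ :=
    fun h => by simpa using (wordPerm n L).symm.injective h
  obtain ⟨L', a1, a2, a3⟩ := exists_shorter_word (lt_of_le_of_ne (not_lt.1 hlt) hne) L
    (fun s hs => h1 s (by simp [hs])) (by simp [Fin.lt_def])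
  have := h3 L' a1 (by
    rw [a3, ← h2, wordPerm_cons, adjSwap_of_lt ht, Equiv.mul_swap_eq_swap_mul]
    simp [Equiv.swap_comm])
  simp at this
  omega

/-- The permutations obtained by multiplying out the subwords of `L`. -/
def subwordPerms (n : ℕ) : List ℕ → Set (Equiv.Perm (Fin n))
  | [] => {1}
  | t :: L => {u | u ∈ subwordPerms n L ∨ adjSwap n t * u ∈ subwordPerms n L}

theorem comp_symm_adjSwap_mul {n t : ℕ} (ht : t + 1 < n) (χ : Fin n → ℕ)
    (v : Equiv.Perm (Fin n)) :
    χ ∘ (adjSwap n t * v).symm =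
      (χ ∘ v.symm) ∘ Equiv.swap ⟨t, Nat.lt_of_succ_lt ht⟩ ⟨t + 1, ht⟩ := by
  rw [adjSwap_of_lt ht]
  funext m
  rfl

theorem suffixSum_subword_le_of_le_one {n : ℕ} {χ : Fin n → ℕ} (hχ : Antitone χ)
    (hχ1 : ∀ m, χ m ≤ 1) (L : List ℕ) (hL : IsReducedWord n L (wordPerm n L))
    {u : Equiv.Perm (Fin n)} (hu : u ∈ subwordPerms n L) (M : ℕ) :
    suffixSum (χ ∘ u.symm) M ≤ suffixSum (χ ∘ (wordPerm n L).symm) M := by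
  induction L generalizing u M with
  | nil =>
    have : u = 1 := hu
    simp [this, wordPerm]
  | cons t L ih =>
    have ht : t + 1 < n := hL.1 t (by simp)
    have hlt := hL.symm_lt_symm ht
    have ih := @ih hL.of_cons
    rw [wordPerm_cons, comp_symm_adjSwap_mul ht]
    set v := wordPerm n L
    set i : Fin n := ⟨t, Nat.lt_of_succ_lt ht⟩ with hi
    set j : Fin n := ⟨t + 1, ht⟩ with hj
    have hij : (j : ℕ) = i + 1 := rfl
    have hv : (χ ∘ v.symm) j ≤ (χ ∘ v.symm) i := hχ hlt.le
    have hsplit : ∀ f : Fin n → ℕ, suffixSum f i = f i + suffixSum f j ∧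
        suffixSum f j = f j + suffixSum f (j + 1) := fun f =>
      ⟨suffixSum_eq_add f i, suffixSum_eq_add f j⟩
    rcases hu with hu | hu
    · refine (ih hu M).trans ?_
      by_cases hM : M = j
      · subst hM
        rw [suffixSum_swap_at _ hij, (hsplit _).2]
        omega
      · rw [suffixSum_comp_swap _ hij hM]
    · have hu' : u = adjSwap n t * (adjSwap n t * u) := by
        rw [← mul_assoc, adjSwap_mul_self, one_mul]
      rw [hu', comp_symm_adjSwap_mul ht]
      set u' := adjSwap n t * u
      by_cases hM : M = j
      · subst hM
        rw [suffixSum_swap_at _ hij, suffixSum_swap_at _ hij]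
        have e1 := ih hu i
        have e2 := ih hu (j + 1)
        rw [(hsplit _).1, (hsplit _).2, (hsplit (χ ∘ v.symm)).1, (hsplit (χ ∘ v.symm)).2] at e1
        have b1 : (χ ∘ u'.symm) i ≤ 1 := hχ1 _
        omega
      · rw [suffixSum_comp_swap _ hij hM, suffixSum_comp_swap _ hij hM]
        exact ih hu M

theorem suffixSum_subword_le {n : ℕ} {lam : Fin n → ℕ} (hlam : Antitone lam)
    (L : List ℕ) (hL : IsReducedWord n L (wordPerm n L))
    {u : Equiv.Perm (Fin n)} (hu : u ∈ subwordPerms n L) (M : ℕ) :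
    suffixSum (lam ∘ u.symm) M ≤ suffixSum (lam ∘ (wordPerm n L).symm) M := by
  obtain ⟨C, hC⟩ : ∃ C, ∀ m, lam m ≤ C := ⟨∑ m, lam m, fun m =>
    Finset.single_le_sum (f := lam) (fun _ _ => Nat.zero_le _) (Finset.mem_univ m)⟩
  have layer : ∀ v : Equiv.Perm (Fin n), suffixSum (lam ∘ v.symm) M =
      ∑ c ∈ Finset.range C, suffixSum ((fun m => if c < lam m then 1 else 0) ∘ v.symm) M := by
    intro v
    unfold suffixSum
    rw [Finset.sum_comm]
    refine Finset.sum_congr rfl fun m _ => ?_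
    split_ifs
    · have : (Finset.range C).filter (fun c => c < lam (v.symm m)) =
          Finset.range (lam (v.symm m)) := by
        ext c
        have := hC (v.symm m)
        simp only [Finset.mem_filter, Finset.mem_range]
        omega
      simp [this]
    · simp
  rw [layer, layer]
  refine Finset.sum_le_sum fun c _ => suffixSum_subword_le_of_le_one ?_ ?_ L hL hu M
  · intro a b hab
    have := hlam hab
    dsimp only
    split_ifs <;> omega
  · intro m
    split_ifs <;> omega


theorem monomial_add_single_add_single {F : Type*} [Field F] {n : ℕ} (r : Fin n →₀ ℕ)
    (i j : Fin n) (a b : ℕ) :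
    (monomial (r + Finsupp.single i a + Finsupp.single j b) 1 : MvPolynomial (Fin n) F) =
      monomial r 1 * (X i ^ a * X j ^ b) := by
  rw [X_pow_eq_monomial, X_pow_eq_monomial, monomial_mul, monomial_mul, add_assoc]
  simp

theorem exists_pibar_monomial (F : Type*) [Field F] {n : ℕ} {i j : Fin n} (hij : i ≠ j)
    (e : Fin n →₀ ℕ) :
    ∃ q : MvPolynomial (Fin n) F,
      (X i - X j) * q = X j * (monomial e 1 - rename (Equiv.swap i j) (monomial e 1)) ∧
      (∀ d ∈ q.support, (∀ m, m ≠ i → m ≠ j → d m = e m) ∧ d i + d j = e i + e j ∧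
        d i ≤ max (e i) (e j) ∧ d j ≤ max (e i) (e j)) ∧
      (e j < e i → coeff (e.mapDomain (Equiv.swap i j)) q = 1) := by
  obtain ⟨r, hri, hrj, a, b, rfl⟩ : ∃ r : Fin n →₀ ℕ, r i = 0 ∧ r j = 0 ∧ ∃ a b,
      e = r + Finsupp.single i a + Finsupp.single j b := by
    refine ⟨(e.erase i).erase j, by simp [Finsupp.erase_ne hij], by simp, e i, e j, ?_⟩
    ext m
    by_cases h1 : m = i
    · subst h1; simp [Finsupp.erase_ne hij, hij]
    · by_cases h2 : m = j
      · subst h2; simp [hij.symm]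
      · simp [Finsupp.erase_ne, h1, h2]
  have hvi : ∀ a b : ℕ, (r + Finsupp.single i a + Finsupp.single j b) i = a := by
    intro a b; simp [hri, hij.symm]
  have hvj : ∀ a b : ℕ, (r + Finsupp.single i a + Finsupp.single j b) j = b := by
    intro a b; simp [hrj, hij]
  have hvm : ∀ (a b : ℕ) (m : Fin n), m ≠ i → m ≠ j →
      (r + Finsupp.single i a + Finsupp.single j b) m = r m := by
    intro a b m h1 h2; simp [h1.symm, h2.symm]
  have hswap : ∀ a b, (r + Finsupp.single i a + Finsupp.single j b).mapDomain (Equiv.swap i j) =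
      r + Finsupp.single i b + Finsupp.single j a := by
    intro a b
    ext m
    rw [Finsupp.mapDomain_equiv_apply, Equiv.symm_swap]
    by_cases h1 : m = i
    · subst h1; rw [Equiv.swap_apply_left, hvj, hvi]
    · by_cases h2 : m = j
      · subst h2; rw [Equiv.swap_apply_right, hvj, hvi]
      · rw [Equiv.swap_apply_of_ne_of_ne h1 h2, hvm _ _ _ h1 h2, hvm _ _ _ h1 h2]
  rw [rename_monomial, hswap, hvi, hvj]
  let Q : ℕ → ℕ → MvPolynomial (Fin n) F := fun b c => ∑ l ∈ Finset.range c,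
    monomial (r + Finsupp.single i (b + l) + Finsupp.single j (b + 1 + (c - 1 - l))) 1
  have hQ : ∀ b c, (X i - X j) * Q b c = X j *
      (monomial (r + Finsupp.single i (b + c) + Finsupp.single j b) 1 -
        monomial (r + Finsupp.single i b + Finsupp.single j (b + c)) 1) := by
    intro b c
    have hg := geom_sum₂_mul (X i : MvPolynomial (Fin n) F) (X j) c
    have : Q b c = monomial r 1 * (X i ^ b * X j ^ (b + 1)) *
        ∑ l ∈ Finset.range c, X i ^ l * X j ^ (c - 1 - l) := by
      simp only [Q, monomial_add_single_add_single]
      rw [Finset.mul_sum]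
      exact Finset.sum_congr rfl fun l _ => by ring
    rw [this, monomial_add_single_add_single, monomial_add_single_add_single]
    linear_combination (monomial r 1 * (X i ^ b * X j ^ (b + 1))) * hg
  have hQs : ∀ b c, ∀ d ∈ (Q b c).support, ∃ l < c,
      d = r + Finsupp.single i (b + l) + Finsupp.single j (b + 1 + (c - 1 - l)) := by
    intro b c d hd
    rw [mem_support_iff] at hd
    simp only [Q, coeff_sum, coeff_monomial] at hd
    obtain ⟨l, hl, hne⟩ := Finset.exists_ne_zero_of_sum_ne_zero hd
    refine ⟨l, Finset.mem_range.1 hl, ?_⟩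
    by_contra h
    exact hne (if_neg (Ne.symm h))
  rcases le_total b a with hab | hab
  · obtain ⟨c, rfl⟩ := Nat.exists_eq_add_of_le hab
    refine ⟨Q b c, hQ b c, fun d hd => ?_, fun hlt => ?_⟩
    · obtain ⟨l, hl, rfl⟩ := hQs b c d hd
      refine ⟨fun m h1 h2 => by rw [hvm _ _ _ h1 h2, hvm _ _ _ h1 h2], ?_, ?_, ?_⟩ <;>
        simp only [hvi, hvj] <;> omega
    · simp only [Q, coeff_sum, coeff_monomial]
      rw [Finset.sum_eq_single_of_mem 0 (Finset.mem_range.2 (by omega))]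
      · rw [if_pos]
        congr 2
        omega
      · intro l _ hl
        rw [if_neg]
        intro h
        have := DFunLike.congr_fun h i
        rw [hvi, hvi] at this
        omega
  · obtain ⟨c, rfl⟩ := Nat.exists_eq_add_of_le hab
    refine ⟨-Q a c, ?_, fun d hd => ?_, fun hlt => by omega⟩
    · rw [mul_neg, hQ]; ring
    · rw [support_neg] at hd
      obtain ⟨l, hl, rfl⟩ := hQs a c d hd
      refine ⟨fun m h1 h2 => by rw [hvm _ _ _ h1 h2, hvm _ _ _ h1 h2], ?_, ?_, ?_⟩ <;>
        simp only [hvi, hvj] <;> omega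

/-- The image under `π̄` expands over the support of the argument, with each monomial
contributing only monomials on its own string. -/
theorem pibarRel_expansion {F : Type*} [Field F] {n t : ℕ} (ht : t + 1 < n)
    {f g : MvPolynomial (Fin n) F} (h : PibarRel F n t f g) :
    ∃ q : (Fin n →₀ ℕ) → MvPolynomial (Fin n) F,
      g = ∑ e ∈ f.support, C (coeff e f) * q e ∧
      ∀ e, (∀ d ∈ (q e).support,
        (∀ m, m ≠ ⟨t, Nat.lt_of_succ_lt ht⟩ → m ≠ ⟨t + 1, ht⟩ → d m = e m) ∧
        d ⟨t, Nat.lt_of_succ_lt ht⟩ + d ⟨t + 1, ht⟩ =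
          e ⟨t, Nat.lt_of_succ_lt ht⟩ + e ⟨t + 1, ht⟩ ∧
        d ⟨t, Nat.lt_of_succ_lt ht⟩ ≤
          max (e ⟨t, Nat.lt_of_succ_lt ht⟩) (e ⟨t + 1, ht⟩) ∧
        d ⟨t + 1, ht⟩ ≤ max (e ⟨t, Nat.lt_of_succ_lt ht⟩) (e ⟨t + 1, ht⟩)) ∧
      (e ⟨t + 1, ht⟩ < e ⟨t, Nat.lt_of_succ_lt ht⟩ →
        coeff (e.mapDomain (adjSwap n t)) (q e) = 1) := by
  unfold PibarRel at h
  rw [adjSwap_of_lt ht] at h ⊢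
  have hX1 : Xv F n t = X ⟨t, Nat.lt_of_succ_lt ht⟩ := dif_pos _
  have hX2 : Xv F n (t + 1) = X ⟨t + 1, ht⟩ := dif_pos _
  rw [hX1, hX2] at h
  set i : Fin n := ⟨t, Nat.lt_of_succ_lt ht⟩
  set j : Fin n := ⟨t + 1, ht⟩
  have hij : i ≠ j := by simp [i, j]
  choose q hq1 hq2 hq3 using exists_pibar_monomial F hij
  refine ⟨q, ?_, fun e => ⟨hq2 e, hq3 e⟩⟩
  have hne : (X i - X j : MvPolynomial (Fin n) F) ≠ 0 :=
    sub_ne_zero.2 fun h => hij (X_injective h)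
  apply mul_left_cancel₀ hne
  rw [h, Finset.mul_sum]
  have hf : ∀ e ∈ f.support, (X i - X j) * (C (coeff e f) * q e) =
      X j * (C (coeff e f) * monomial e 1 -
        rename (Equiv.swap i j) (C (coeff e f) * monomial e 1)) := by
    intro e _
    rw [map_mul, rename_C]
    linear_combination C (coeff e f) * hq1 e
  rw [Finset.sum_congr rfl hf, ← Finset.mul_sum, Finset.sum_sub_distrib, ← map_sum]
  have : ∑ e ∈ f.support, C (coeff e f) * monomial e 1 = f := by
    simp only [C_mul_monomial, mul_one]
    exact f.as_sum.symm
  rw [this]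


theorem PibarChain.of_cons {F : Type*} [Field F] {n t : ℕ} {L : List ℕ}
    {g : ℕ → MvPolynomial (Fin n) F} (h : PibarChain F n (t :: L) g) :
    PibarChain F n L g ∧ PibarRel F n t (g L.length) (g (L.length + 1)) := by
  refine ⟨fun s hs => ?_, ?_⟩
  · have := h s (by simp; omega)
    rwa [List.reverse_cons, List.getD_append _ _ _ _ (by simpa using hs)] at this
  · have := h L.length (by simp)
    rwa [List.reverse_cons, List.getD_append_right _ _ _ _ (by simp), List.length_reverse,
      Nat.sub_self, List.getD_cons_zero] at this

/-- Every monomial in the chain lies in the convex hull of the exponents attached to the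
subwords, expressed through the support functions of coordinate subsets. -/
theorem exists_subword_sum_le {F : Type*} [Field F] {n : ℕ} {lam : Fin n → ℕ} (L : List ℕ)
    (hL : ∀ t ∈ L, t + 1 < n) {g : ℕ → MvPolynomial (Fin n) F}
    (h0 : g 0 = monomial (Finsupp.equivFunOnFinite.symm lam) 1) (hg : PibarChain F n L g)
    {d : Fin n →₀ ℕ} (hd : d ∈ (g L.length).support) (c : Fin n → ℕ) (hc : ∀ m, c m ≤ 1) :
    ∃ u ∈ subwordPerms n L, ∑ m, c m * d m ≤ ∑ m, c m * lam (u.symm m) := by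
  induction L generalizing d c with
  | nil =>
    refine ⟨1, rfl, le_of_eq ?_⟩
    rw [List.length_nil, h0, mem_support_iff, coeff_monomial] at hd
    have : Finsupp.equivFunOnFinite.symm lam = d := by
      by_contra h
      exact hd (if_neg h)
    subst this
    rfl
  | cons t L ih =>
    have ht : t + 1 < n := hL t (by simp)
    have ih := @ih (fun s hs => hL s (by simp [hs])) hg.of_cons.1
    obtain ⟨q, hq, hqs⟩ := pibarRel_expansion ht hg.of_cons.2
    rw [List.length_cons, hq, mem_support_iff, coeff_sum] at hd
    obtain ⟨e, he, hne⟩ := Finset.exists_ne_zero_of_sum_ne_zero hd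
    rw [coeff_C_mul] at hne
    obtain ⟨hoff, hsum, hi, hj⟩ := (hqs e).1 d (mem_support_iff.2 (right_ne_zero_of_mul hne))
    set i : Fin n := ⟨t, Nat.lt_of_succ_lt ht⟩ with hi_def
    set j : Fin n := ⟨t + 1, ht⟩ with hj_def
    have hij : i ≠ j := by simp [i, j]
    have hsplit : ∀ f : Fin n → ℕ, ∑ m, f m =
        f i + f j + ∑ m ∈ (Finset.univ.erase i).erase j, f m := by
      intro f
      rw [← Finset.add_sum_erase _ f (Finset.mem_univ i),
        ← Finset.add_sum_erase _ f (Finset.mem_erase.2 ⟨hij.symm, Finset.mem_univ j⟩), add_assoc]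
    have key : ∑ m, c m * d m ≤ ∑ m, c m * e m ∨
        ∑ m, c m * d m ≤ ∑ m, c (Equiv.swap i j m) * e m := by
      have e1 : ∑ m ∈ (Finset.univ.erase i).erase j, c m * d m =
          ∑ m ∈ (Finset.univ.erase i).erase j, c m * e m := by
        refine Finset.sum_congr rfl fun m hm => ?_
        simp only [Finset.mem_erase] at hm
        rw [hoff m hm.2.1 hm.1]
      have e2 : ∑ m ∈ (Finset.univ.erase i).erase j, c (Equiv.swap i j m) * e m =
          ∑ m ∈ (Finset.univ.erase i).erase j, c m * e m := by
        refine Finset.sum_congr rfl fun m hm => ?_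
        simp only [Finset.mem_erase] at hm
        rw [Equiv.swap_apply_of_ne_of_ne hm.2.1 hm.1]
      rw [hsplit fun m => c m * d m, hsplit fun m => c m * e m,
        hsplit fun m => c (Equiv.swap i j m) * e m, e1, e2]
      simp only [Equiv.swap_apply_left, Equiv.swap_apply_right]
      have c1 := hc i
      have c2 := hc j
      interval_cases c i <;> interval_cases c j <;> omega
    rcases key with key | key
    · obtain ⟨u, hu, hle⟩ := ih he c hc
      exact ⟨u, Or.inl hu, key.trans hle⟩
    · obtain ⟨u, hu, hle⟩ := ih he (fun m => c (Equiv.swap i j m)) fun m => hc _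
      refine ⟨adjSwap n t * u, Or.inr ?_, key.trans (hle.trans (le_of_eq ?_))⟩
      · rwa [← mul_assoc, adjSwap_mul_self, one_mul]
      · rw [← Equiv.sum_comp (Equiv.swap i j)]
        refine Finset.sum_congr rfl fun m _ => ?_
        have := congrFun (comp_symm_adjSwap_mul ht lam u) m
        simp only [Function.comp] at this
        rw [this, Equiv.swap_apply_self]

theorem sum_indicator_mul_eq_suffixSum {n : ℕ} (f : Fin n → ℕ) (M : ℕ) :
    ∑ m : Fin n, (if M ≤ (m : ℕ) then 1 else 0) * f m = suffixSum f M := by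
  simp [suffixSum]

theorem suffixSum_le_of_mem_support {F : Type*} [Field F] {n : ℕ} {lam : Fin n → ℕ}
    (hlam : Antitone lam) (L : List ℕ) (hL : IsReducedWord n L (wordPerm n L))
    {g : ℕ → MvPolynomial (Fin n) F}
    (h0 : g 0 = monomial (Finsupp.equivFunOnFinite.symm lam) 1) (hg : PibarChain F n L g)
    {d : Fin n →₀ ℕ} (hd : d ∈ (g L.length).support) (M : ℕ) :
    suffixSum d M ≤ suffixSum (lam ∘ (wordPerm n L).symm) M := by
  obtain ⟨u, hu, hle⟩ := exists_subword_sum_le L hL.1 h0 hg hd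
    (fun m => if M ≤ (m : ℕ) then 1 else 0) (fun m => by split_ifs <;> omega)
  rw [sum_indicator_mul_eq_suffixSum] at hle
  refine hle.trans ((le_of_eq ?_).trans (suffixSum_subword_le hlam L hL hu M))
  exact sum_indicator_mul_eq_suffixSum (lam ∘ u.symm) M

theorem suffixSum_swap_le_of_mem_support {F : Type*} [Field F] {n t : ℕ} {lam : Fin n → ℕ}
    (hlam : Antitone lam) (L : List ℕ) (ht : t + 1 < n)
    (hL : IsReducedWord n (t :: L) (wordPerm n (t :: L)))
    {g : ℕ → MvPolynomial (Fin n) F}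
    (h0 : g 0 = monomial (Finsupp.equivFunOnFinite.symm lam) 1) (hg : PibarChain F n L g)
    {d : Fin n →₀ ℕ} (hd : d ∈ (g L.length).support) (M : ℕ) :
    suffixSum (d ∘ Equiv.swap ⟨t, Nat.lt_of_succ_lt ht⟩ ⟨t + 1, ht⟩) M ≤
      suffixSum (lam ∘ (wordPerm n (t :: L)).symm) M := by
  set s := Equiv.swap (⟨t, Nat.lt_of_succ_lt ht⟩ : Fin n) ⟨t + 1, ht⟩ with hs
  obtain ⟨u, hu, hle⟩ := exists_subword_sum_le L hL.of_cons.1 h0 hg hd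
    (fun m => if M ≤ (s m : ℕ) then 1 else 0) (fun m => by split_ifs <;> omega)
  have hu' : adjSwap n t * u ∈ subwordPerms n (t :: L) :=
    Or.inr (by rwa [← mul_assoc, adjSwap_mul_self, one_mul])
  refine le_trans ?_ (suffixSum_subword_le hlam (t :: L) hL hu' M)
  rw [comp_symm_adjSwap_mul ht]
  rw [← Equiv.sum_comp s, ← Equiv.sum_comp s fun m => _ * lam (u.symm m)] at hle
  simpa [suffixSum, hs, Function.comp] using hle

theorem coeff_pibarChain {F : Type*} [Field F] {n : ℕ} {lam : Fin n → ℕ}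
    (hlam : Antitone lam) (L : List ℕ) (hL : IsReducedWord n L (wordPerm n L))
    (hdrop : ∀ a b, a < b → wordPerm n L b < wordPerm n L a → lam b < lam a)
    {g : ℕ → MvPolynomial (Fin n) F}
    (h0 : g 0 = monomial (Finsupp.equivFunOnFinite.symm lam) 1) (hg : PibarChain F n L g) :
    coeff (Finsupp.equivFunOnFinite.symm (lam ∘ (wordPerm n L).symm)) (g L.length) = 1 := by
  induction L with
  | nil =>
    rw [List.length_nil, h0, coeff_monomial, if_pos]
    rfl
  | cons t L ih =>
    have ht : t + 1 < n := hL.1 t (by simp)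
    have hlt := hL.symm_lt_symm ht
    obtain ⟨q, hq, hqs⟩ := pibarRel_expansion ht hg.of_cons.2
    have hdom := @suffixSum_le_of_mem_support F _ n lam hlam L hL.of_cons g h0 hg.of_cons.1
    have hdom' := @suffixSum_swap_le_of_mem_support F _ n t lam hlam L ht hL g h0 hg.of_cons.1
    have hmap : Finsupp.equivFunOnFinite.symm (lam ∘ (wordPerm n (t :: L)).symm) =
        (Finsupp.equivFunOnFinite.symm (lam ∘ (wordPerm n L).symm)).mapDomain (adjSwap n t) := by
      rw [wordPerm_cons, comp_symm_adjSwap_mul ht, adjSwap_of_lt ht]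
      ext m
      rw [Finsupp.mapDomain_equiv_apply]
      rfl
    rw [wordPerm_cons, comp_symm_adjSwap_mul ht] at hdom'
    have hdrop' : ∀ a b, a < b → wordPerm n L b < wordPerm n L a → lam b < lam a := by
      intro a b hab hv
      refine hdrop a b hab ?_
      by_contra hcon
      have key : wordPerm n L b = ⟨t, Nat.lt_of_succ_lt ht⟩ ∧
          wordPerm n L a = ⟨t + 1, ht⟩ := by
        rw [wordPerm_cons, adjSwap_of_lt ht] at hcon
        simp only [Equiv.Perm.mul_apply, Equiv.swap_apply_def] at hcon
        simp only [Fin.ext_iff, Fin.lt_def] at hcon hv ⊢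
        split_ifs at hcon <;> simp_all <;> omega
      rw [← key.1, ← key.2] at hlt
      simp only [Equiv.symm_apply_apply] at hlt
      exact absurd hab hlt.asymm
    have ih := ih hL.of_cons hdrop' hg.of_cons.1
    rw [hmap, List.length_cons]
    set v := wordPerm n L with hv_def
    set f : Fin n →₀ ℕ := Finsupp.equivFunOnFinite.symm (lam ∘ v.symm) with hf
    have hfc : (lam ∘ v.symm) = ⇑f := rfl
    rw [hfc] at hdom hdom'
    set i : Fin n := ⟨t, Nat.lt_of_succ_lt ht⟩ with hi_def
    set j : Fin n := ⟨t + 1, ht⟩ with hj_def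
    have hij : (j : ℕ) = i + 1 := rfl
    have hne : i ≠ j := by simp [i, j]
    have hfij : f j < f i := by
      refine hdrop _ _ hlt ?_
      rw [wordPerm_cons, adjSwap_of_lt ht]
      simp [Fin.lt_def, i, j, v]
    have hfsupp : f ∈ (g L.length).support := by
      rw [mem_support_iff, ih]
      exact one_ne_zero
    rw [hq, coeff_sum, Finset.sum_eq_single_of_mem f hfsupp]
    · rw [coeff_C_mul, ih, one_mul]
      exact (hqs f).2 hfij
    · intro e he hef
      rw [coeff_C_mul]
      by_contra hcoef
      obtain ⟨hoff, hsum, -, hmax⟩ :=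
        (hqs e).1 _ (mem_support_iff.2 (right_ne_zero_of_mul hcoef))
      rw [adjSwap_of_lt ht] at hoff hsum hmax
      simp only [Finsupp.mapDomain_equiv_apply, Equiv.symm_swap] at hoff hsum hmax
      rw [Equiv.swap_apply_left, Equiv.swap_apply_right] at hsum
      rw [Equiv.swap_apply_right] at hmax
      change f j + f i = e i + e j at hsum
      change f i ≤ max (e i) (e j) at hmax
      have hoff' : ∀ m, m ≠ i → m ≠ j → f m = e m := fun m h1 h2 => by
        rw [← hoff m h1 h2, Equiv.swap_apply_of_ne_of_ne h1 h2]
      have htail : suffixSum e (j + 1) = suffixSum f (j + 1) := by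
        refine Finset.sum_congr rfl fun m _ => ?_
        split_ifs with hm
        · refine (hoff' m ?_ ?_).symm <;> rintro rfl <;> omega
        · rfl
      have b1 := hdom he j
      have b2 := hdom' he j
      rw [suffixSum_eq_add, suffixSum_eq_add] at b1
      rw [suffixSum_swap_at _ hij, suffixSum_swap_at _ hij] at b2
      apply hef
      ext m
      by_cases h1 : m = i
      · rw [h1]; omega
      · by_cases h2 : m = j
        · rw [h2]; omega
        · exact (hoff' m h1 h2).symm


/-- The exponent of the variable at 0-based position `t` in `x_{α,i}`. -/
def xAIExp (α : List ℕ) (i : ℕ → ℕ) (t : ℕ) : ℕ :=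
  ((desComp α).filter fun r => t + 1 ≤ r).card + i t

theorem xAI_eq_prod (F : Type*) [Field F] (n : ℕ) (α : List ℕ) (i : ℕ → ℕ)
    (h : ∀ r ∈ desComp α, r ≤ n) :
    xAI F n α i = ∏ t : Fin n, X t ^ xAIExp α i t := by
  have hX : ∀ t : Fin n, Xv F n t = X t := fun t => dif_pos t.2
  have h1 : ∀ r ∈ desComp α, ∏ t ∈ Finset.range r, Xv F n t =
      ∏ t : Fin n, if (t : ℕ) + 1 ≤ r then X t else 1 := by
    intro r hr
    have hr := h r hr
    have : Finset.range r = (Finset.range n).filter fun t => t + 1 ≤ r := by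
      ext t
      simp only [Finset.mem_range, Finset.mem_filter]
      omega
    rw [this, Finset.prod_filter, ← Fin.prod_univ_eq_prod_range
      (fun t => if t + 1 ≤ r then Xv F n t else 1)]
    simp only [hX]
  unfold xAI
  rw [Finset.prod_congr rfl h1, Finset.prod_comm,
    ← Fin.prod_univ_eq_prod_range (fun t => Xv F n t ^ i t), ← Finset.prod_mul_distrib]
  refine Finset.prod_congr rfl fun t _ => ?_
  rw [hX, xAIExp, pow_add, ← Finset.prod_filter, Finset.prod_const]

theorem card_filter_succ_le (D : Finset ℕ) (t : ℕ) :
    (D.filter fun r => t + 1 ≤ r).card =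
      (D.filter fun r => t + 1 + 1 ≤ r).card + if t + 1 ∈ D then 1 else 0 := by
  have h : (D.filter fun r => t + 1 ≤ r) =
      (D.filter fun r => t + 1 + 1 ≤ r) ∪ D.filter fun r => r = t + 1 := by
    ext r
    simp only [Finset.mem_filter, Finset.mem_union, ← and_or_left]
    refine and_congr_right fun _ => ?_
    omega
  rw [h, Finset.card_union_of_disjoint]
  · rw [Finset.filter_eq']
    split_ifs <;> simp
  · rw [Finset.disjoint_filter]
    intros
    omega

theorem lt_of_mem_desComp {α : List ℕ} {m r : ℕ} (h : m < α.headI) (hr : r ∈ desComp α) :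
    m < r := by
  simp only [desComp, Finset.mem_image, Finset.mem_filter, Finset.mem_range] at hr
  obtain ⟨t, ⟨ht, ht0⟩, rfl⟩ := hr
  obtain ⟨s, rfl⟩ := Nat.exists_eq_succ_of_ne_zero ht0.ne'
  cases α with
  | nil => simp at ht
  | cons a β =>
    simp only [List.headI_cons] at h
    simp only [List.take_succ_cons, List.sum_cons]
    omega

theorem card_desComp_le (α : List ℕ) : (desComp α).card ≤ α.length - 1 := by
  refine Finset.card_image_le.trans (le_of_eq ?_)
  have : (Finset.range α.length).filter (fun t => 0 < t) = Finset.Ico 1 α.length := by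
    ext t
    simp only [Finset.mem_filter, Finset.mem_range, Finset.mem_Ico]
    omega
  rw [this, Nat.card_Ico]

/-- A decreasing sequence that drops at each descent of `w` drops along each inversion. -/
theorem lt_of_inversion {n : ℕ} {lam : ℕ → ℕ} (hlam : Antitone lam) {w : Equiv.Perm (Fin n)}
    (hdes : ∀ t, t + 1 ∈ permDes w → lam (t + 1) < lam t) {a b : Fin n} (hab : a < b)
    (hinv : w b < w a) : lam b < lam a := by
  by_contra hcon
  have hmono : ∀ m, (a : ℕ) + m ≤ b → permVal w a ≤ permVal w (a + m) := by
    intro m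
    induction m with
    | zero => intro; rfl
    | succ m ih =>
      intro hm
      refine (ih (by omega)).trans ?_
      by_contra hlt
      have hd : (a : ℕ) + m + 1 ∈ permDes w := by
        simp only [permDes, Finset.mem_filter, Finset.mem_Ico]
        refine ⟨by omega, ?_⟩
        simpa [add_assoc] using hlt
      have h1 := hdes _ hd
      have h2 := hlam (show (a : ℕ) ≤ a + m by omega)
      have h3 := hlam (show (a : ℕ) + m + 1 ≤ b by omega)
      omega
  have h := hmono (b - a) (by omega)
  rw [Nat.add_sub_cancel' (le_of_lt hab)] at h
  simp only [permVal, Fin.is_lt, dif_pos] at h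
  exact absurd hinv (not_lt.2 h)

/-- Let `(α, i) ∈ A_{n,k}` and let `w ∈ S_n` satisfy
`Des(α) ⊆ Des(w) ⊆ Des(α ∪ i)`. Then, for any reduced word of `w`, the polynomial
`π̄_w(x_{α,i})` has neglex-leading term (with coefficient `1`) the monomial
`w(x_{α,i})`; moreover `w(x_{α,i}) = gs_{w,i'}` where
`i'_j = i_j - #{r ∈ Des(w) ∩ [n-k] : r ≥ j}`, and `gs_{w,i'}` belongs to `GS_{n,k}`. -/
theorem pibar_xAI_leading_term (F : Type*) [Field F] (n k : ℕ)
    (hk : 1 ≤ k) (hkn : k ≤ n)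
    (α : List ℕ) (i : ℕ → ℕ) (hA : Acond n k α i)
    (w : Equiv.Perm (Fin n))
    (hw1 : desComp α ⊆ permDes w)
    (hw2 : permDes w ⊆ desComp α ∪ seqDes n i)
    (p : MvPolynomial (Fin n) F)
    (hp : IsPibarApplied F n w (xAI F n α i) p)
    (i' : ℕ → ℕ)
    (hi' : ∀ t : ℕ,
      i' t = i t - ((permDes w).filter fun r => r ≤ n - k ∧ t + 1 ≤ r).card) :
    MvPolynomial.rename (⇑w) (xAI F n α i) = gsMono F n w i' ∧
    GScond n k w i' ∧
    MvPolynomial.coeff (Finsupp.equivFunOnFinite.symm (gsExp w i')) p = 1 ∧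
    ∀ e ∈ p.support,
      e ≠ Finsupp.equivFunOnFinite.symm (gsExp w i') → NeglexLt ⇑e (gsExp w i') := by
  obtain ⟨⟨-, -⟩, hhead, hlen, hmono, hzero⟩ := hA
  have hdc : ∀ r ∈ desComp α, n - k < r := fun r hr => lt_of_mem_desComp hhead hr
  have hsd : ∀ r ∈ seqDes n i, r ≤ n - k ∧ i r < i (r - 1) := by
    intro r hr
    simp only [seqDes, Finset.mem_filter, Finset.mem_Ico] at hr
    refine ⟨?_, hr.2⟩
    by_contra hgt
    have := hzero (r - 1) (by omega)
    omega
  set D := (permDes w).filter fun r => r ≤ n - k with hD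
  have hDsd : ∀ r ∈ D, i r < i (r - 1) := by
    intro r hr
    rw [hD, Finset.mem_filter] at hr
    rcases Finset.mem_union.1 (hw2 hr.1) with h | h
    · exact absurd (hdc r h) (by omega)
    · exact (hsd r h).2
  have hunion : permDes w = desComp α ∪ D := by
    ext r
    rw [hD, Finset.mem_union, Finset.mem_filter]
    refine ⟨fun h => ?_, fun h => h.elim (fun h => hw1 h) fun h => h.1⟩
    rcases Finset.mem_union.1 (hw2 h) with h' | h'
    · exact Or.inl h'
    · exact Or.inr ⟨h, (hsd r h').1⟩
  have hdisj : Disjoint (desComp α) D := by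
    rw [Finset.disjoint_left]
    intro r hr hr'
    have := hdc r hr
    rw [hD, Finset.mem_filter] at hr'
    omega
  have hi'D : ∀ t, i' t = i t - (D.filter fun r => t + 1 ≤ r).card := by
    intro t
    rw [hi', hD, Finset.filter_filter]
  have hstep : ∀ t, i (t + 1) + (if t + 1 ∈ D then 1 else 0) ≤ i t := by
    intro t
    split_ifs with h
    · have := hDsd _ h
      simp only [Nat.add_sub_cancel] at this
      omega
    · by_cases ht : t + 1 < n - k
      · exact hmono t (t + 1) (by omega) ht
      · rw [hzero (t + 1) (by omega)]
        omega
  have hcard : ∀ m t, n - k ≤ t + m → (D.filter fun r => t + 1 ≤ r).card ≤ i t := by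
    intro m
    induction m with
    | zero =>
      intro t ht
      have : (D.filter fun r => t + 1 ≤ r) = ∅ := by
        rw [hD, Finset.filter_filter, Finset.filter_eq_empty_iff]
        intro r _
        omega
      rw [this, Finset.card_empty]
      exact Nat.zero_le _
    | succ m ih =>
      intro t ht
      have h1 := ih (t + 1) (by omega)
      have h2 := hstep t
      rw [card_filter_succ_le]
      omega
  have hci : ∀ t, (D.filter fun r => t + 1 ≤ r).card ≤ i t := fun t => hcard (n - k) t (by omega)
  have hexp : ∀ t, ((permDes w).filter fun r => t + 1 ≤ r).card + i' t = xAIExp α i t := by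
    intro t
    have := hci t
    rw [hunion, Finset.filter_union, Finset.card_union_of_disjoint
      (Finset.disjoint_filter_filter hdisj), hi'D, xAIExp]
    omega
  have hanti : Antitone (xAIExp α i) := by
    refine antitone_nat_of_succ_le fun t => ?_
    have := hstep t
    unfold xAIExp
    rw [card_filter_succ_le _ t]
    omega
  have hdes : ∀ t, t + 1 ∈ permDes w → xAIExp α i (t + 1) < xAIExp α i t := by
    intro t ht
    have := hstep t
    unfold xAIExp
    rw [card_filter_succ_le _ t]
    rw [hunion, Finset.mem_union] at ht
    rcases ht with h | h <;> simp only [h, if_true] at this ⊢ <;> omega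
  have hgs : gsExp w i' = (fun t : Fin n => xAIExp α i t) ∘ w.symm := by
    funext m
    exact hexp (w.symm m)
  have hx := xAI_eq_prod F n α i fun r hr => by
    have := hw1 hr
    simp only [permDes, Finset.mem_filter, Finset.mem_Ico] at this
    omega
  have hxm : xAI F n α i =
      monomial (Finsupp.equivFunOnFinite.symm fun t : Fin n => xAIExp α i t) 1 := by
    rw [hx, monomial_eq, C_1, one_mul, Finsupp.prod_fintype _ _ fun _ => pow_zero _]
    rfl
  refine ⟨?_, ⟨?_, ?_, ?_⟩, ?_⟩
  · rw [hx, gsMono, hgs, map_prod,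
      ← Equiv.prod_comp w fun m => X m ^ ((fun t : Fin n => xAIExp α i t) ∘ w.symm) m]
    simp
  · have h1 : (permDes w).card = (desComp α).card + (D.filter fun r => 0 + 1 ≤ r).card := by
      rw [hunion, Finset.card_union_of_disjoint hdisj]
      congr 2
      refine (Finset.filter_true_of_mem fun r hr => ?_).symm
      rw [hD, Finset.mem_filter, permDes, Finset.mem_filter, Finset.mem_Ico] at hr
      omega
    have h2 := card_desComp_le α
    have h3 := hci 0
    have h4 : α.length ≠ 0 := by
      intro h
      rw [List.length_eq_zero_iff.1 h] at hhead
      simp at hhead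
    rw [h1, hi'D]
    omega
  · intro a b hab _
    refine antitone_nat_of_succ_le (f := i') (fun t => ?_) hab
    have := hstep t
    rw [hi'D, hi'D, card_filter_succ_le _ t]
    omega
  · intro t ht
    rw [hi'D, hzero t ht, Nat.zero_sub]
  · obtain ⟨L, g, hL, h0, hg, rfl⟩ := hp
    obtain rfl : wordPerm n L = w := hL.2.1
    rw [hxm] at h0
    have hlam : Antitone fun t : Fin n => xAIExp α i t := fun a b hab => hanti hab
    have hdrop : ∀ a b : Fin n, a < b → wordPerm n L b < wordPerm n L a →
        xAIExp α i b < xAIExp α i a := fun a b hab => lt_of_inversion hanti hdes hab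
    rw [hgs]
    refine ⟨coeff_pibarChain hlam L hL hdrop h0 hg, fun e he hne => ?_⟩
    refine neglexLt_of_suffixSum_le (suffixSum_le_of_mem_support hlam L hL h0 hg he) ?_
    intro h
    exact hne (DFunLike.coe_injective h)

end OSPHecke
end
end

section
/- Let F be a field and α = (α_1,…,α_ℓ) a composition of n. Equip the free F-vector space F[OP_α] on ordered set partitions of shape α with the operators π_i (1 ≤ i ≤ n−1) defined by: π_i(σ) = 0 if i+1 lies in a block strictly to the left of the block of i in σ; π_i(σ) = σ if i and i+1 lie in the same block; and π_i(σ) = σ + s_i(σ) if i+1 lies in a block strictly to the right of the block of i, where s_i(σ) exchanges the letters i and i+1. Then F[OP_α] is cyclic, generated by the ordered set partition σ_0 = ({1,…,α_1} | {α_1+1,…,α_1+α_2} | ⋯ | {n−α_ℓ+1,…,n}): the smallest F-subspace of F[OP_α] containing σ_0 and closed under all the operators π_1,…,π_{n−1} is F[OP_α] itself. -/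
open scoped Classical
open MvPolynomial

noncomputable section

namespace OSPHecke

section Fibers

variable {n ℓ : ℕ}

/-- The tuple of blocks whose `j`-th block consists of the letters sent to `j`. -/
def fibers (c : Fin n → Fin ℓ) : Fin ℓ → Finset (Fin n) := fun j =>
  Finset.univ.filter fun x => c x = j

theorem mem_fibers (c : Fin n → Fin ℓ) (j : Fin ℓ) (x : Fin n) : x ∈ fibers c j ↔ c x = j := by
  simp [fibers]

theorem blkLeft_fibers (c : Fin n → Fin ℓ) (a b : Fin n) :
    blkLeft (fibers c) a b ↔ c b < c a := by
  simp [blkLeft, mem_fibers]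

theorem blkSame_fibers (c : Fin n → Fin ℓ) (a b : Fin n) :
    blkSame (fibers c) a b ↔ c a = c b := by
  simp [blkSame, mem_fibers, eq_comm]

theorem image_fibers (c : Fin n → Fin ℓ) (e : Equiv.Perm (Fin n)) :
    (fun j => (fibers c j).image e) = fibers (c ∘ e.symm) := by
  funext j
  ext x
  simp only [Finset.mem_image, mem_fibers, Function.comp_apply]
  constructor
  · rintro ⟨y, hy, rfl⟩
    simpa using hy
  · exact fun h => ⟨e.symm x, h, e.apply_symm_apply x⟩

theorem card_fibers_comp (c : Fin n → Fin ℓ) (e : Equiv.Perm (Fin n)) (j : Fin ℓ) :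
    (fibers (c ∘ e) j).card = (fibers c j).card := by
  have h := congrFun (image_fibers c e.symm) j
  rw [Equiv.symm_symm] at h
  rw [← h, Finset.card_image_of_injective _ e.symm.injective]

theorem shapeImg_fibers (F : Type*) [Field F] (c : Fin n → Fin ℓ) (a b : Fin n) :
    shapeImg F a b (fibers c) =
      if c b < c a then 0
      else if c a = c b then Finsupp.single (fibers c) 1
      else Finsupp.single (fibers c) 1 +
        Finsupp.single (fibers (c ∘ Equiv.swap a b)) 1 := by
  unfold shapeImg
  rw [image_fibers, Equiv.symm_swap]
  simp only [blkLeft_fibers, blkSame_fibers]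

theorem shapeOp_single (F : Type*) [Field F] (a b : Fin n) (B : Fin ℓ → Finset (Fin n)) :
    shapeOp F a b (Finsupp.single B 1) = shapeImg F a b B := by
  simp [shapeOp]

theorem shapeOp_eq_linearCombination (F : Type*) [Field F] (a b : Fin n)
    (f : (Fin ℓ → Finset (Fin n)) →₀ F) :
    shapeOp F a b f = Finsupp.linearCombination F (shapeImg F a b) f :=
  rfl

theorem monotone_of_le_next {β : Type*} [Preorder β] (c : Fin n → β)
    (h : ∀ (t : ℕ) (ht : t + 1 < n), c ⟨t, Nat.lt_of_succ_lt ht⟩ ≤ c ⟨t + 1, ht⟩) :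
    Monotone c := by
  cases n with
  | zero => exact fun x => x.elim0
  | succ m => exact Fin.monotone_iff_le_succ.2 fun i => h i (Nat.succ_lt_succ i.2)

theorem mem_iff_lt_card_of_isLowerSet (S : Finset (Fin n))
    (hS : IsLowerSet (S : Set (Fin n))) (x : Fin n) : x ∈ S ↔ (x : ℕ) < S.card := by
  constructor
  · intro hx
    have hsub : Finset.Iic x ⊆ S := fun y hy => hS (Finset.mem_Iic.1 hy) hx
    have := Finset.card_le_card hsub
    rw [Fin.card_Iic] at this
    omega
  · intro hx
    by_contra hxS
    have hsub : S ⊆ Finset.Iio x := fun y hy =>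
      Finset.mem_Iio.2 (lt_of_not_ge fun hxy => hxS (hS hxy hy))
    have := Finset.card_le_card hsub
    rw [Fin.card_Iio] at this
    omega

end Fibers

theorem isOSPShape_fibers (α : List ℕ) (c : Fin α.sum → Fin α.length) :
    IsOSPShape α (fibers c) ↔ ∀ j, (fibers c j).card = α.get j := by
  refine ⟨fun h => h.1, fun h => ⟨h, fun j l hjl x hx hx' => ?_, fun x => ⟨c x, ?_⟩⟩⟩
  · rw [mem_fibers] at hx hx'
    exact hjl (hx.symm.trans hx')
  · rw [mem_fibers]

theorem IsOSPShape.exists_eq_fibers {α : List ℕ} {B : Fin α.length → Finset (Fin α.sum)}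
    (hB : IsOSPShape α B) : ∃ c, B = fibers c := by
  choose c hc using hB.2.2
  refine ⟨c, funext fun j => Finset.ext fun x => ?_⟩
  rw [mem_fibers]
  refine ⟨fun hx => ?_, fun h => h ▸ hc x⟩
  by_contra hne
  exact hB.2.1 _ _ hne x (hc x) hx

theorem card_filter_lt_eq_sum_take (α : List ℕ) (c : Fin α.sum → Fin α.length)
    (hc : ∀ j, (fibers c j).card = α.get j) (m : ℕ) (hm : m ≤ α.length) :
    (Finset.univ.filter fun x => (c x : ℕ) < m).card = (α.take m).sum := by
  induction m with
  | zero => simp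
  | succ m ih =>
    have hsplit : (Finset.univ.filter fun x => (c x : ℕ) < m + 1) =
        (Finset.univ.filter fun x => (c x : ℕ) < m) ∪ fibers c ⟨m, hm⟩ := by
      ext x
      simp only [Finset.mem_filter, Finset.mem_univ, true_and, Finset.mem_union, mem_fibers,
        Fin.ext_iff]
      omega
    rw [hsplit, Finset.card_union_of_disjoint, ih (by omega), hc, List.sum_take_succ α m hm]
    · rfl
    · rw [Finset.disjoint_left]
      intro x hx hx'
      rw [mem_fibers] at hx'
      simp [hx'] at hx

theorem fibers_eq_sigma0_of_monotone (α : List ℕ) (c : Fin α.sum → Fin α.length)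
    (hc : ∀ j, (fibers c j).card = α.get j) (hmono : Monotone c) : fibers c = sigma0 α := by
  have key (x : Fin α.sum) (m : ℕ) (hm : m ≤ α.length) :
      (c x : ℕ) < m ↔ (x : ℕ) < (α.take m).sum := by
    rw [← card_filter_lt_eq_sum_take α c hc m hm, ← mem_iff_lt_card_of_isLowerSet]
    · simp
    · intro y z hzy hy
      simp only [Finset.coe_filter, Finset.mem_univ, true_and, Set.mem_ofPred_eq] at hy ⊢
      exact lt_of_le_of_lt (hmono hzy) hy
  funext j
  ext x
  simp only [mem_fibers, sigma0, Finset.mem_filter, Finset.mem_univ, true_and]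
  rw [← key x (j + 1) j.2, ← not_lt, ← key x j j.2.le, Fin.ext_iff]
  omega

theorem isOSPShape_sigma0 (α : List ℕ) : IsOSPShape α (sigma0 α) := by
  have hcard : Fintype.card (Fin α.sum) = Fintype.card (Σ j : Fin α.length, Fin (α.get j)) := by
    simp [Fin.sum_univ_getElem]
  let e := Fintype.equivOfCardEq hcard
  let c : Fin α.sum → Fin α.length := fun x => (e x).1
  have hc (j : Fin α.length) : (fibers c j).card = α.get j := by
    have himg : fibers c j =
        Finset.univ.map ((Function.Embedding.sigmaMk (β := fun j => Fin (α.get j)) j).trans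
          e.symm.toEmbedding) := by
      ext x
      simp only [mem_fibers, Finset.mem_map, Finset.mem_univ, true_and,
        Function.Embedding.trans_apply, Function.Embedding.sigmaMk_apply,
        Equiv.coe_toEmbedding, Equiv.symm_apply_eq]
      constructor
      · rintro rfl
        exact ⟨(e x).2, rfl⟩
      · rintro ⟨y, hy⟩
        exact (congrArg Sigma.fst hy).symm
    rw [himg, Finset.card_map, Finset.card_univ, Fintype.card_fin]
  have hsorted (j : Fin α.length) : (fibers (c ∘ Tuple.sort c) j).card = α.get j := by
    rw [card_fibers_comp, hc]
  rw [← fibers_eq_sigma0_of_monotone α _ hsorted (Tuple.monotone_sort c), isOSPShape_fibers]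
  exact hsorted

/-- Straightening: a letter pair `t, t+1` out of order in `c` can be put in order, which makes `c`
lexicographically smaller, and `π_t` recovers `c` from the result. -/
theorem single_fibers_mem (F : Type*) [Field F] (α : List ℕ)
    (V : Submodule F ((Fin α.length → Finset (Fin α.sum)) →₀ F))
    (h0 : Finsupp.single (sigma0 α) (1 : F) ∈ V)
    (hV : ∀ (t : ℕ) (ht : t + 1 < α.sum), ∀ f ∈ V,
      shapeOp F ⟨t, Nat.lt_of_succ_lt ht⟩ ⟨t + 1, ht⟩ f ∈ V)
    (c : Lex (Fin α.sum → Fin α.length))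
    (hc : ∀ j, (fibers (ofLex c) j).card = α.get j) :
    Finsupp.single (fibers (ofLex c)) (1 : F) ∈ V := by
  induction c using WellFoundedLT.induction with
  | ind c ih =>
  by_cases hmono : Monotone (ofLex c)
  · rwa [fibers_eq_sigma0_of_monotone α _ hc hmono]
  · obtain ⟨t, ht, hlt⟩ : ∃ (t : ℕ) (ht : t + 1 < α.sum),
        ofLex c ⟨t + 1, ht⟩ < ofLex c ⟨t, Nat.lt_of_succ_lt ht⟩ := by
      by_contra! hcon
      exact hmono (monotone_of_le_next _ hcon)
    set a : Fin α.sum := ⟨t, Nat.lt_of_succ_lt ht⟩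
    set b : Fin α.sum := ⟨t + 1, ht⟩
    have hab : a < b := Fin.mk_lt_mk.2 (Nat.lt_succ_self t)
    set d : Fin α.sum → Fin α.length := ofLex c ∘ Equiv.swap a b with hd
    have hda : d a = ofLex c b := by simp [hd]
    have hdb : d b = ofLex c a := by simp [hd]
    have hmem : Finsupp.single (fibers d) (1 : F) ∈ V :=
      ih (toLex d) (Pi.lex_desc hab.le hlt) fun j => (card_fibers_comp _ _ j).trans (hc j)
    have hop := hV t ht _ hmem
    have hback : d ∘ Equiv.swap a b = ofLex c := by
      funext x
      simp [hd]
    rw [shapeOp_single, shapeImg_fibers, hda, hdb, if_neg hlt.not_gt, if_neg hlt.ne, hback] at hop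
    exact (Submodule.add_mem_iff_right V hmem).1 hop

theorem shapeOp_mem_span (F : Type*) [Field F] (α : List ℕ) (a b : Fin α.sum)
    (f : (Fin α.length → Finset (Fin α.sum)) →₀ F)
    (hf : f ∈ Submodule.span F {f : (Fin α.length → Finset (Fin α.sum)) →₀ F |
      ∃ B, IsOSPShape α B ∧ f = Finsupp.single B 1}) :
    shapeOp F a b f ∈ Submodule.span F {f : (Fin α.length → Finset (Fin α.sum)) →₀ F |
      ∃ B, IsOSPShape α B ∧ f = Finsupp.single B 1} := by
  rw [shapeOp_eq_linearCombination]
  rw [← Submodule.mem_comap]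
  refine Submodule.span_le.2 ?_ hf
  rintro _ ⟨B, hB, rfl⟩
  obtain ⟨c, rfl⟩ := hB.exists_eq_fibers
  rw [SetLike.mem_coe, Submodule.mem_comap, Finsupp.linearCombination_single, one_smul,
    shapeImg_fibers]
  split_ifs
  · exact Submodule.zero_mem _
  · exact Submodule.subset_span ⟨_, hB, rfl⟩
  · refine Submodule.add_mem _ (Submodule.subset_span ⟨_, hB, rfl⟩)
      (Submodule.subset_span ⟨_, (isOSPShape_fibers α _).2 fun j => ?_, rfl⟩)
    rw [card_fibers_comp, hB.1]

/-- `F[OP_α]` is a cyclic module under the 0-Hecke operators `π_i`,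
generated by `σ_0 = ({1,…,α_1} | {α_1+1,…,α_1+α_2} | ⋯)`: inside the free `F`-module on
all tuples of blocks, the smallest subspace containing `σ_0` and closed under all the
operators `π_1, …, π_{n-1}` is exactly the span of the ordered set partitions of
shape `α`, i.e. `F[OP_α]` itself. -/
theorem OSP_shape_cyclic (F : Type*) [Field F] (α : List ℕ) (hα : ∀ a ∈ α, 0 < a) :
    sInf {V : Submodule F ((Fin α.length → Finset (Fin α.sum)) →₀ F) |
        Finsupp.single (sigma0 α) (1 : F) ∈ V ∧
        ∀ (t : ℕ) (ht : t + 1 < α.sum), ∀ f ∈ V,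
          shapeOp F ⟨t, Nat.lt_of_succ_lt ht⟩ ⟨t + 1, ht⟩ f ∈ V} =
      Submodule.span F
        {f : (Fin α.length → Finset (Fin α.sum)) →₀ F |
          ∃ B : Fin α.length → Finset (Fin α.sum),
            IsOSPShape α B ∧ f = Finsupp.single B 1} := by
  apply le_antisymm
  · exact sInf_le ⟨Submodule.subset_span ⟨_, isOSPShape_sigma0 α, rfl⟩,
      fun t ht f hf => shapeOp_mem_span F α _ _ f hf⟩
  · refine le_sInf fun V ⟨h0, hV⟩ => Submodule.span_le.2 ?_
    rintro _ ⟨B, hB, rfl⟩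
    obtain ⟨c, rfl⟩ := hB.exists_eq_fibers
    exact single_fibers_mem F α V h0 hV (toLex c) hB.1

end OSPHecke
end
end
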